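/- Let φ : ℝⁿ → ℝ be C¹, strictly convex, with φ(x)/‖x‖ → ∞ at infinity and ∫ e^{-φ} dx = 1. Then for every λ > 0 and every smooth enough g : ℝⁿ → ℝ (with all integrals finite), Ent_{dx}(e^g) ≤ −n log(λe) ∫ e^g dx + ∫ φ*(−λ∇g) e^g dx, where Ent_{dx}(e^g) = ∫ e^g log(e^g/∫e^g dx) dx and φ* is the Legendre transform of φ. Moreover, equality holds for λ = 1 and g(x) = −φ(x − x̄), where x̄ ∈ ℝⁿ. -/

import Mathlib

open MeasureTheory Real Filter Bornology
open scoped RealInnerProductSpace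

/-- The Legendre (Fenchel) transform of `φ`. -/
noncomputable def legendre {n : ℕ} (φ : EuclideanSpace ℝ (Fin n) → ℝ)
    (y : EuclideanSpace ℝ (Fin n)) : ℝ :=
  ⨆ z, ⟪y, z⟫ - φ z

/-- The entropy of `f` with respect to `μ`. -/
noncomputable def Ent {n : ℕ} (μ : Measure (EuclideanSpace ℝ (Fin n)))
    (f : EuclideanSpace ℝ (Fin n) → ℝ) : ℝ :=
  ∫ x, f x * Real.log (f x / ∫ y, f y ∂μ) ∂μ

open scoped Topology

section OneDimensional

variable {F G H : ℝ → ℝ}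

/-- A primitive of a continuous function bounded below by a positive constant is a
`C¹` diffeomorphism of the line. -/
theorem exists_inverse_primitive (hH : Continuous H) {c : ℝ} (hc : 0 < c) (hcH : ∀ y, c ≤ H y)
    (a : ℝ) :
    ∃ J : ℝ → ℝ, Continuous J ∧ (∀ s, (∫ y in a..J s, H y) = s) ∧
      (∀ t, J (∫ y in a..t, H y) = t) ∧ StrictMono J ∧
      ∀ s, HasDerivAt J (H (J s))⁻¹ s := by
  set K : ℝ → ℝ := fun t => ∫ y in a..t, H y with hK
  have hpos : ∀ y, 0 < H y := fun y => hc.trans_le (hcH y)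
  have hder : ∀ t, HasDerivAt K (H t) t := fun t =>
    (hH.integral_hasStrictDerivAt a t).hasDerivAt
  have hmono : StrictMono K := strictMono_of_deriv_pos fun t => by
    rw [(hder t).deriv]; exact hpos t
  have hcont : Continuous K := continuous_iff_continuousAt.2 fun t => (hder t).continuousAt
  have hdiff : Monotone fun t => K t - c * t := by
    refine monotone_of_deriv_nonneg (fun t => ?_) fun t => ?_
    · exact ((hder t).sub ((hasDerivAt_id t).const_mul c)).differentiableAt
    · rw [show deriv (fun t => K t - c * t) t = H t - c * 1 from
        ((hder t).sub ((hasDerivAt_id t).const_mul c)).deriv]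
      simpa using hcH t
  have htop : Tendsto K atTop atTop := by
    refine tendsto_atTop_mono' _ ?_
      (tendsto_atTop_add_const_left _ (K 0) (tendsto_id.const_mul_atTop hc))
    filter_upwards [eventually_ge_atTop 0] with t ht
    have := hdiff ht
    simp only [id] at *
    linarith
  have hbot : Tendsto K atBot atBot := by
    refine tendsto_atBot_mono' _ ?_
      (tendsto_atBot_add_const_left _ (K 0) (tendsto_id.const_mul_atBot hc))
    filter_upwards [eventually_le_atBot 0] with t ht
    have := hdiff ht
    simp only [id] at *
    linarith
  let e := hmono.orderIsoOfSurjective K (hcont.surjective htop hbot)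
  have hes : ∀ s, K (e.symm s) = s := fun s => e.apply_symm_apply s
  have hcs : Continuous e.symm := e.symm.continuous
  exact ⟨e.symm, hcs, hes, fun t => e.symm_apply_apply t, e.symm.strictMono, fun s =>
    HasDerivAt.of_local_left_inverse hcs.continuousAt (hder _) (hpos _).ne'
      (Eventually.of_forall hes)⟩

/-- A function with an integrable derivative `G` in the integrated sense is continuous. -/
theorem continuous_of_primitive (hG : Integrable G) (hFG : ∀ a b, F b - F a = ∫ t in a..b, G t) :
    Continuous F := by
  have h : F = fun x => F 0 + ∫ t in (0 : ℝ)..x, G t := by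
    ext x; linarith [hFG 0 x]
  rw [h]
  exact continuous_const.add (intervalIntegral.continuous_primitive
    (fun _ _ => hG.intervalIntegrable) 0)

theorem abs_le_of_primitive (hG : Integrable G) (hFG : ∀ a b, F b - F a = ∫ t in a..b, G t)
    (x : ℝ) :
    |F x| ≤ |F 0| + ∫ t, |G t| := by
  have h1 : F x = F 0 + ∫ t in (0 : ℝ)..x, G t := by linarith [hFG 0 x]
  have h2 : |∫ t in (0 : ℝ)..x, G t| ≤ ∫ t, |G t| := by
    refine (intervalIntegral.norm_integral_le_integral_norm_uIoc (f := G) (μ := volume)).trans ?_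
    exact setIntegral_le_integral hG.norm (Eventually.of_forall fun _ => norm_nonneg _)
  rw [h1]
  exact (abs_add_le _ _).trans (by linarith)

theorem tendsto_zero_atTop_of_primitive (hF : Integrable F) (hG : Integrable G)
    (hFG : ∀ a b, F b - F a = ∫ t in a..b, G t) : Tendsto F atTop (𝓝 0) := by
  have h : F = fun x => F 0 + ∫ t in (0 : ℝ)..x, G t := by
    ext x; linarith [hFG 0 x]
  have hlim : Tendsto F atTop (𝓝 (F 0 + ∫ t in Set.Ioi 0, G t)) := by
    rw [h]
    simp only [intervalIntegral.integral_same, add_zero]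
    exact tendsto_const_nhds.add
      (intervalIntegral_tendsto_integral_Ioi 0 hG.integrableOn tendsto_id)
  have h0 : F 0 + ∫ t in Set.Ioi 0, G t = 0 := by
    refine IntegrableAtFilter.eq_zero_of_tendsto (hF.integrableAtFilter atTop) ?_ hlim
    intro s hs
    rcases mem_atTop_sets.1 hs with ⟨b, hb⟩
    rw [← top_le_iff, ← volume_Ici (a := b)]
    exact measure_mono hb
  rwa [h0] at hlim

theorem tendsto_zero_atBot_of_primitive (hF : Integrable F) (hG : Integrable G)
    (hFG : ∀ a b, F b - F a = ∫ t in a..b, G t) : Tendsto F atBot (𝓝 0) := by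
  have h := tendsto_zero_atTop_of_primitive (F := fun x => F (-x)) (G := fun x => -G (-x))
    hF.comp_neg hG.comp_neg.neg fun a b => by
      rw [hFG, intervalIntegral.integral_neg, intervalIntegral.integral_comp_neg,
        intervalIntegral.integral_symm]
  simpa [Function.comp_def] using h.comp tendsto_neg_atBot_atTop

/-- Integration by parts on the line against a bounded `C¹` function. -/
theorem integral_primitive_mul_add_eq_zero (hF : Integrable F) (hG : Integrable G)
    (hFG : ∀ a b, F b - F a = ∫ t in a..b, G t) {T T' : ℝ → ℝ} {R : ℝ}
    (hT : ∀ x, HasDerivAt T (T' x) x) (hT' : Continuous T') (hR : ∀ x, |T x| ≤ R)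
    (hFT : Integrable fun x => F x * T' x) :
    Integrable (fun x => G x * T x) ∧ ∫ x, (G x * T x + F x * T' x) = 0 := by
  have hTc : Continuous T := continuous_iff_continuousAt.2 fun t => (hT t).continuousAt
  have hGT : Integrable fun x => G x * T x :=
    hG.mul_bdd (c := R) hTc.aestronglyMeasurable (Eventually.of_forall hR)
  refine ⟨hGT, ?_⟩
  have hae : ∀ᵐ x, HasDerivAt F (G x) x := by
    filter_upwards [LocallyIntegrable.ae_hasDerivAt_integral hG.locallyIntegrable] with x hx
    have h : F = fun x => F 0 + ∫ t in (0 : ℝ)..x, G t := by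
      ext x; linarith [hFG 0 x]
    rw [h]
    exact (hx 0).const_add _
  have hFac : ∀ a b, AbsolutelyContinuousOnInterval F a b := fun a b => by
    have h : F = fun x => F a + ∫ t in a..x, G t := by
      ext x; linarith [hFG a x]
    rw [h]
    exact (ContDiffOn.absolutelyContinuousOnInterval contDiffOn_const).add
      ((hG.intervalIntegrable (a := a)
        (b := b)).absolutelyContinuousOnInterval_intervalIntegral (c := a) (by simp))
  have hTC1 : ContDiff ℝ 1 T := by
    rw [contDiff_one_iff_deriv]
    refine ⟨fun x => (hT x).differentiableAt, ?_⟩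
    rwa [show deriv T = T' from funext fun x => (hT x).deriv]
  have hparts : ∀ b : ℝ, ∫ x in (-b)..b, (G x * T x + F x * T' x)
      = F b * T b - F (-b) * T (-b) := fun b => by
    rw [← AbsolutelyContinuousOnInterval.integral_deriv_mul_eq_sub (hFac (-b) b)
      hTC1.contDiffOn.absolutelyContinuousOnInterval]
    refine intervalIntegral.integral_congr_ae ?_
    filter_upwards [hae] with x hx _
    rw [hx.deriv, (hT x).deriv]
  have h1 := intervalIntegral_tendsto_integral (hGT.add hFT) tendsto_neg_atTop_atBot tendsto_id
  have hbdd : ∀ {l : Filter ℝ}, Tendsto F l (𝓝 0) → Tendsto (fun x => F x * T x) l (𝓝 0) := by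
    intro l hl
    refine squeeze_zero_norm (a := fun x => |F x| * R) (fun x => ?_)
      (by simpa using hl.abs.mul_const R)
    rw [norm_mul]
    exact mul_le_mul_of_nonneg_left (hR x) (abs_nonneg _)
  have h2 : Tendsto (fun b : ℝ => F b * T b - F (-b) * T (-b)) atTop (𝓝 0) := by
    simpa using (hbdd (tendsto_zero_atTop_of_primitive hF hG hFG)).sub
      ((hbdd (tendsto_zero_atBot_of_primitive hF hG hFG)).comp tendsto_neg_atTop_atBot)
  refine tendsto_nhds_unique h1 (h2.congr fun b => ?_)
  simpa using (hparts b).symm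

/-- The one-dimensional log-Sobolev type inequality, proved by monotone transport of `F` onto the
restriction of `H` to `[-R, R]`. -/
theorem one_dimensional_log_sobolev {Z : ℝ → ℝ} {R : ℝ} (hR : 0 < R)
    (hFpos : ∀ x, 0 < F x) (hF : Integrable F) (hG : Integrable G)
    (hFG : ∀ a b, F b - F a = ∫ t in a..b, G t)
    (hFlog : Integrable fun x => F x * log (F x))
    (hH : Continuous H) (hHpos : ∀ y, 0 < H y) (hZ : Integrable Z)
    (hle : ∀ᵐ x, ∀ y ∈ Set.Icc (-R) R, F x * log (H y) - y * G x ≤ Z x) :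
    (∫ x, F x * log (F x)) - (∫ x, F x) * log (∫ x, F x)
      + (∫ x, F x) * (1 + log (∫ y in Set.Icc (-R) R, H y)) ≤ ∫ x, Z x := by
  have hRR : -R ≤ R := by linarith
  set M := ∫ x, F x with hM
  have hMpos : 0 < M := by
    rw [hM, integral_pos_iff_support_of_nonneg (fun x => (hFpos x).le) hF,
      show Function.support F = Set.univ from Set.eq_univ_of_forall fun x => (hFpos x).ne']
    simp
  set q : ℝ → ℝ := fun y => max (-R) (min y R) with hq
  have hqmem : ∀ y, q y ∈ Set.Icc (-R) R := fun y =>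
    ⟨le_max_left _ _, max_le hRR (min_le_right _ _)⟩
  have hqid : ∀ y ∈ Set.Icc (-R) R, q y = y := fun y hy => by
    simp only [hq, min_eq_left hy.2, max_eq_right hy.1]
  have hHq : Continuous fun y => H (q y) := by fun_prop
  obtain ⟨c, hc, hcH⟩ : ∃ c, 0 < c ∧ ∀ y, c ≤ H (q y) := by
    obtain ⟨y₀, _, hy₀⟩ := isCompact_Icc.exists_isMinOn (Set.nonempty_Icc.2 hRR) hH.continuousOn
    exact ⟨H y₀, hHpos _, fun y => hy₀ (hqmem y)⟩
  obtain ⟨J, hJc, hKJ, hJK, hJm, hJd⟩ := exists_inverse_primitive hHq hc hcH (-R)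
  set m := ∫ y in Set.Icc (-R) R, H y with hm
  have hmK : ∫ y in (-R)..R, H (q y) = m := by
    rw [hm, integral_Icc_eq_integral_Ioc, intervalIntegral.integral_of_le hRR]
    refine setIntegral_congr_fun measurableSet_Ioc fun y hy => ?_
    simp only [hqid y ⟨hy.1.le, hy.2⟩]
  have hmpos : 0 < m := by
    rw [← hmK]
    exact intervalIntegral.intervalIntegral_pos_of_pos (hHq.intervalIntegrable _ _)
      (fun y => hHpos _) (by linarith)
  have hFc := continuous_of_primitive hG hFG
  have hmM : 0 < m / M := div_pos hmpos hMpos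
  set S : ℝ → ℝ := fun x => m / M * ((∫ t in Set.Iic 0, F t) + ∫ t in (0 : ℝ)..x, F t) with hS
  have hSd : ∀ x, HasDerivAt S (m / M * F x) x := fun x =>
    ((hFc.integral_hasStrictDerivAt 0 x).hasDerivAt.const_add _).const_mul _
  have hS' : ∀ x, S x = m / M * ∫ t in Set.Iic x, F t := fun x => by
    simp only [hS]
    rw [← intervalIntegral.integral_Iic_sub_Iic hF.integrableOn hF.integrableOn]
    simp
  have hS0 : ∀ x, 0 ≤ S x := fun x => by
    rw [hS']
    exact mul_nonneg hmM.le (integral_nonneg fun t => (hFpos t).le)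
  have hSm : ∀ x, S x ≤ m := fun x => by
    have h1 : ∫ t in Set.Iic x, F t ≤ M :=
      setIntegral_le_integral hF (Eventually.of_forall fun t => (hFpos t).le)
    rw [hS']
    calc m / M * ∫ t in Set.Iic x, F t ≤ m / M * M := by gcongr
      _ = m := by field_simp
  have hTmem : ∀ x, J (S x) ∈ Set.Icc (-R) R := fun x => by
    have h1 := hJK (-R)
    have h2 := hJK R
    rw [intervalIntegral.integral_same] at h1
    rw [hmK] at h2
    constructor
    · rw [← h1]; exact hJm.monotone (hS0 x)
    · conv_rhs => rw [← h2]
      exact hJm.monotone (hSm x)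
  set T : ℝ → ℝ := fun x => J (S x) with hT
  set T' : ℝ → ℝ := fun x => (H (T x))⁻¹ * (m / M * F x) with hT'
  have hSc : Continuous S := continuous_iff_continuousAt.2 fun t => (hSd t).continuousAt
  have hTc : Continuous T := hJc.comp hSc
  have hTd : ∀ x, HasDerivAt T (T' x) x := fun x => by
    have h := (hJd (S x)).comp x (hSd x)
    rwa [hqid _ (hTmem x)] at h
  have hT'c : Continuous T' :=
    ((hH.comp hTc).inv₀ fun x => (hHpos _).ne').mul (continuous_const.mul hFc)
  have hT'pos : ∀ x, 0 < T' x := fun x =>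
    mul_pos (inv_pos.2 (hHpos _)) (mul_pos hmM (hFpos x))
  have hFT' : Integrable fun x => F x * T' x := by
    refine hF.mul_bdd (c := c⁻¹ * (m / M * (|F 0| + ∫ t, |G t|))) hT'c.aestronglyMeasurable
      (Eventually.of_forall fun x => ?_)
    rw [Real.norm_of_nonneg (hT'pos x).le]
    have h1 : (H (T x))⁻¹ ≤ c⁻¹ := by
      have := hcH (T x)
      rw [hqid _ (hTmem x)] at this
      gcongr
    have h2 : F x ≤ |F 0| + ∫ t, |G t| := (le_abs_self _).trans (abs_le_of_primitive hG hFG x)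
    have h3 := hFpos x
    exact mul_le_mul h1 (by gcongr) (by positivity) (by positivity)
  obtain ⟨hGT, hzero⟩ := integral_primitive_mul_add_eq_zero hF hG hFG hTd hT'c
    (fun x => abs_le.2 (hTmem x)) hFT'
  have hkey : ∀ᵐ x, F x * log (F x) + (1 + log (m / M)) * F x - (G x * T x + F x * T' x) ≤ Z x := by
    filter_upwards [hle] with x hx
    have h1 := hx (T x) (hTmem x)
    have h2 : log (T' x) = log (m / M) + log (F x) - log (H (T x)) := by
      rw [hT']
      simp only
      rw [log_mul (inv_ne_zero (hHpos _).ne') (mul_pos hmM (hFpos x)).ne',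
        log_mul hmM.ne' (hFpos x).ne', log_inv]
      ring
    have h3 := log_le_sub_one_of_pos (hT'pos x)
    have h4 := mul_le_mul_of_nonneg_left h3 (hFpos x).le
    rw [h2] at h4
    linarith
  have hint1 : Integrable fun x => F x * log (F x) + (1 + log (m / M)) * F x :=
    hFlog.add (hF.const_mul _)
  have hint := integral_mono_ae (hint1.sub (hGT.add hFT')) hZ hkey
  have hcalc : ∫ x, ((fun x => F x * log (F x) + (1 + log (m / M)) * F x) -
      ((fun x => G x * T x) + fun x => F x * T' x)) x
      = (∫ x, F x * log (F x)) + (1 + log (m / M)) * M := by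
    rw [integral_sub' hint1 (hGT.add hFT'), integral_add hFlog (hF.const_mul _),
      integral_const_mul]
    simp only [Pi.add_apply, hzero, sub_zero, hM]
  have hfin := hcalc.symm.le.trans hint
  rw [log_div hmpos.ne' hMpos.ne'] at hfin
  linarith

end OneDimensional

section Tensorization

theorem integrable_slice_of_integrable_deriv {E : Type*} [TopologicalSpace E]
    [MeasurableSpace E] {μ : Measure E} [SFinite μ]
    {f D : ℝ × E → ℝ}
    (hD : ∀ t z, HasDerivAt (fun s => f (s, z)) (D (t, z)) t) (hDc : Continuous D)
    (hf : Integrable f (volume.prod μ)) (hDi : Integrable D (volume.prod μ)) :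
    (∀ t, Integrable (fun z => f (t, z)) μ) ∧
      ∀ a b, (∫ z, f (b, z) ∂μ) - ∫ z, f (a, z) ∂μ = ∫ t in a..b, ∫ z, D (t, z) ∂μ := by
  have hftc : ∀ a b z, ∫ t in a..b, D (t, z) = f (b, z) - f (a, z) := fun a b z =>
    intervalIntegral.integral_eq_sub_of_hasDerivAt (fun t _ => hD t z)
      ((hDc.comp (by fun_prop : Continuous fun t : ℝ => (t, z))).intervalIntegrable _ _)
  have hres : ∀ s : Set ℝ, Integrable D ((volume.restrict s).prod μ) := fun s =>
    hDi.mono_measure (Measure.prod_mono Measure.restrict_le_self le_rfl)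
  have hint : ∀ a b, Integrable (fun z => f (b, z) - f (a, z)) μ := fun a b => by
    simp_rw [← hftc, intervalIntegral]
    exact (hres _).integral_prod_right.sub (hres _).integral_prod_right
  obtain ⟨a₀, ha₀⟩ := hf.prod_right_ae.exists
  have hslice : ∀ t, Integrable (fun z => f (t, z)) μ := fun t => by
    refine ((hint a₀ t).add ha₀).congr (Eventually.of_forall fun z => ?_)
    simp
  refine ⟨hslice, fun a b => ?_⟩
  rw [← integral_sub (hslice b) (hslice a),
    intervalIntegral_integral_swap (f := fun t z => D (t, z)) (hres _)]
  simp_rw [hftc]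

variable {E : Type*} [NormedAddCommGroup E] [NormedSpace ℝ E] [MeasurableSpace E]

/-- The log-Sobolev type inequality of dimension `d` associated with the measures of density
`exp (-ψ)` restricted to `B`, for a potential `ψ` that is merely continuous. The function `V`
stands for any upper bound of the Legendre transform of `ψ`, restricted to `B`,
at `-fderiv ℝ g x`. -/
def HasLogSobolev (μ : Measure E) (B : Set E) (d : ℝ) : Prop :=
  ∀ ψ g V : E → ℝ, Continuous ψ → IntegrableOn (fun y => exp (-ψ y)) B μ → ContDiff ℝ 1 g →
    Integrable (fun x => exp (g x)) μ → Integrable (fun x => exp (g x) * g x) μ →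
    Integrable (fun x => exp (g x) * V x) μ →
    (∀ x, ∀ y ∈ B, -(fderiv ℝ g x y) - ψ y ≤ V x) →
    (∫ x, exp (g x) * g x ∂μ) - (∫ x, exp (g x) ∂μ) * log (∫ x, exp (g x) ∂μ)
      + (∫ x, exp (g x) ∂μ) * (d + log (∫ y in B, exp (-ψ y) ∂μ))
      ≤ ∫ x, exp (g x) * V x ∂μ

variable [BorelSpace E]

/-- Tensorization with an interval: apply the inequality on `E` to the slices of `g`, and the
one-dimensional inequality to the marginal of `exp g`. -/
theorem HasLogSobolev.prod [SecondCountableTopology E] {μ : Measure E} [SigmaFinite μ]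
    [IsLocallyFiniteMeasure μ] {B : Set E} {d : ℝ}
    (h : HasLogSobolev μ B d) (hB : IsCompact B) (h0 : (0 : E) ∈ B)
    (hμB : μ B ≠ 0) {R : ℝ} (hR : 0 < R) :
    HasLogSobolev (volume.prod μ) (Set.Icc (-R) R ×ˢ B) (d + 1) := by
  intro ψ g V hψ hψi hg hf hfg hfV hle
  have hgd : Differentiable ℝ g := hg.differentiable one_ne_zero
  set D : ℝ × E → ℝ := fun p => fderiv ℝ g p (1, 0) with hD
  have hDc : Continuous D := (hg.continuous_fderiv one_ne_zero).clm_apply continuous_const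
  have hsplit : ∀ p y z, fderiv ℝ g p (y, z) = y * D p + fderiv ℝ g p (0, z) := fun p y z => by
    rw [show ((y, z) : ℝ × E) = y • (1, 0) + (0, z) by simp, map_add, map_smul, smul_eq_mul]
  have hRR : -R ≤ R := by linarith
  set C := max (ψ (R, 0)) (ψ (-R, 0)) with hC
  have hDV : ∀ p, |D p| * R ≤ V p + C := fun p => by
    have h1 := hle p (R, 0) ⟨⟨hRR, le_rfl⟩, h0⟩
    have h2 := hle p (-R, 0) ⟨⟨le_rfl, hRR⟩, h0⟩
    rw [hsplit, Prod.mk_zero_zero, map_zero] at h1 h2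
    have h3 : ψ (R, 0) ≤ C := le_max_left _ _
    have h4 : ψ (-R, 0) ≤ C := le_max_right _ _
    rcases abs_cases (D p) with ⟨h5, _⟩ | ⟨h5, _⟩ <;> rw [h5] <;> linarith
  have hfD : Integrable (fun p => exp (g p) * D p) (volume.prod μ) := by
    refine ((hfV.add (hf.const_mul C)).div_const R).mono'
      (by have := hg.continuous; fun_prop) (Eventually.of_forall fun p => ?_)
    rw [Real.norm_eq_abs, abs_mul, abs_exp, Pi.add_apply, le_div_iff₀ hR]
    have := mul_le_mul_of_nonneg_left (hDV p) (exp_pos (g p)).le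
    linarith
  have hderiv : ∀ t z, HasDerivAt (fun s => exp (g (s, z))) (exp (g (t, z)) * D (t, z)) t :=
    fun t z => ((hgd (t, z)).hasFDerivAt.comp_hasDerivAt t
      ((hasDerivAt_id t).prodMk (hasDerivAt_const t z))).exp
  obtain ⟨hslice, hFG⟩ := integrable_slice_of_integrable_deriv hderiv
    (by have := hg.continuous; fun_prop) hf hfD
  have hμ : NeZero μ := ⟨by rintro rfl; simp at hμB⟩
  have hFpos : ∀ t, 0 < ∫ z, exp (g (t, z)) ∂μ := fun t => integral_exp_pos (hslice t)
  set F : ℝ → ℝ := fun t => ∫ z, exp (g (t, z)) ∂μ with hF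
  set G : ℝ → ℝ := fun t => ∫ z, exp (g (t, z)) * D (t, z) ∂μ with hG
  set A : ℝ → ℝ := fun t => ∫ z, exp (g (t, z)) * g (t, z) ∂μ with hA
  set U : ℝ → ℝ := fun t => ∫ z, exp (g (t, z)) * V (t, z) ∂μ with hU
  set H : ℝ → ℝ := fun y => ∫ z in B, exp (-ψ (y, z)) ∂μ with hH
  have hFi : Integrable F := hf.integral_prod_left
  have hGi : Integrable G := hfD.integral_prod_left
  have hAi : Integrable A := hfg.integral_prod_left
  have hUi : Integrable U := hfV.integral_prod_left
  have hHc : Continuous H :=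
    continuous_parametric_integral_of_continuous (f := fun y z => exp (-ψ (y, z)))
      (by simp only [Function.uncurry_def]; fun_prop) hB
  have hψs : ∀ y, IntegrableOn (fun z => exp (-ψ (y, z))) B μ := fun y =>
    (by fun_prop : Continuous fun z => exp (-ψ (y, z))).continuousOn.integrableOn_compact hB
  have hHpos : ∀ y, 0 < H y := fun y => by
    have : NeZero (μ.restrict B) := ⟨by simpa [Measure.restrict_eq_zero] using hμB⟩
    exact integral_exp_pos (f := fun z => -ψ (y, z)) (hψs y)
  have hineq : ∀ᵐ t, ∀ y ∈ Set.Icc (-R) R,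
      A t - F t * log (F t) + F t * (d + log (H y)) ≤ U t + y * G t := by
    filter_upwards [hfg.prod_right_ae, hfV.prod_right_ae, hfD.prod_right_ae] with t h1 h2 h3 y hy
    have hVi : Integrable (fun z => exp (g (t, z)) * (V (t, z) + y * D (t, z))) μ := by
      refine (h2.add (h3.const_mul y)).congr (Eventually.of_forall fun z => ?_)
      simp only [Pi.add_apply]; ring
    have key := h (fun z => ψ (y, z)) (fun z => g (t, z)) (fun z => V (t, z) + y * D (t, z))
      (by fun_prop) (hψs y) (hg.comp (contDiff_const.prodMk contDiff_id)) (hslice t) h1 hVi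
      fun z w hw => by
        have h4 := hle (t, z) (y, w) ⟨hy, hw⟩
        have h5 : fderiv ℝ (fun z => g (t, z)) z w = fderiv ℝ g (t, z) (0, w) := by
          have := ((hgd (t, z)).hasFDerivAt.comp z
            ((hasFDerivAt_const t z).prodMk (hasFDerivAt_id z))).fderiv
          simp only [Function.comp_def] at this
          rw [this]
          simp
        rw [hsplit] at h4
        rw [h5]
        linarith
    have h6 : ∫ z, exp (g (t, z)) * (V (t, z) + y * D (t, z)) ∂μ = U t + y * G t := by
      rw [hU, hG]
      simp only
      rw [← integral_const_mul, ← integral_add h2 (h3.const_mul y)]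
      exact integral_congr_ae (Eventually.of_forall fun z => by ring)
    rwa [h6] at key
  have hFlog : Integrable fun t => F t * log (F t) := by
    have hFc := continuous_of_primitive hGi hFG
    refine integrable_of_le_of_le (g₁ := fun t => A t - U t + (d + log (H 0)) * F t)
      (g₂ := fun t => log (|F 0| + ∫ t, |G t|) * F t) ?_ ?_ ?_ ((hAi.sub hUi).add (hFi.const_mul _))
      (hFi.const_mul _)
    · exact (hFc.mul (hFc.log fun t => (hFpos t).ne')).aestronglyMeasurable
    · filter_upwards [hineq] with t ht
      have := ht 0 ⟨by linarith, hR.le⟩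
      linarith
    · refine Eventually.of_forall fun t => ?_
      have h1 : F t ≤ |F 0| + ∫ t, |G t| :=
        (le_abs_self _).trans (abs_le_of_primitive hGi hFG t)
      have h2 := mul_le_mul_of_nonneg_left (log_le_log (hFpos t) h1) (hFpos t).le
      simpa [mul_comm] using h2
  have hfinal := one_dimensional_log_sobolev
    (Z := fun t => U t - A t + F t * log (F t) - d * F t) hR hFpos hFi hGi hFG hFlog hHc hHpos
    (((hUi.sub hAi).add hFlog).sub (hFi.const_mul d)) (by
      filter_upwards [hineq] with t ht y hy
      have := ht y hy
      linarith)
  have hM : ∫ p, exp (g p) ∂(volume.prod μ) = ∫ t, F t := integral_prod _ hf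
  have hm : ∫ p in Set.Icc (-R) R ×ˢ B, exp (-ψ p) ∂(volume.prod μ)
      = ∫ y in Set.Icc (-R) R, H y :=
    setIntegral_prod _ hψi
  have hZ : ∫ t, (U t - A t + F t * log (F t) - d * F t)
      = (∫ t, U t) - (∫ t, A t) + (∫ t, F t * log (F t)) - d * ∫ t, F t := by
    have hUA : Integrable fun t => U t - A t := hUi.sub hAi
    have hUAF : Integrable fun t => U t - A t + F t * log (F t) := hUA.add hFlog
    rw [integral_sub hUAF (hFi.const_mul d), integral_add hUA hFlog, integral_sub hUi hAi,
      integral_const_mul]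
  rw [hZ] at hfinal
  rw [hM, hm, integral_prod _ hfg, integral_prod _ hfV]
  linarith

theorem HasLogSobolev.of_measurePreserving {E' : Type*} [NormedAddCommGroup E']
    [NormedSpace ℝ E'] [MeasurableSpace E'] [BorelSpace E'] {μ : Measure E} {μ' : Measure E'}
    {B : Set E'} {d : ℝ} (e : E ≃L[ℝ] E') (he : MeasurePreserving e μ μ')
    (h : HasLogSobolev μ (e ⁻¹' B) d) : HasLogSobolev μ' B d := by
  intro ψ g V hψ hψi hg hf hfg hfV hle
  have hemb : MeasurableEmbedding e := e.toHomeomorph.measurableEmbedding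
  have key := h (fun x => ψ (e x)) (fun x => g (e x)) (fun x => V (e x)) (hψ.comp e.continuous)
    ((he.integrableOn_comp_preimage hemb).2 hψi) (hg.comp e.contDiff)
    ((he.integrable_comp_emb hemb).2 hf) ((he.integrable_comp_emb hemb).2 hfg)
    ((he.integrable_comp_emb hemb).2 hfV) fun x y hy => by
      have h1 : fderiv ℝ (fun x => g (e x)) x y = fderiv ℝ g (e x) (e y) := by
        rw [show (fun x => g (e x)) = g ∘ e from rfl, e.comp_right_fderiv]
        rfl
      rw [h1]
      exact hle (e x) (e y) hy
  rwa [he.integral_comp hemb (fun x => exp (g x) * g x),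
    he.integral_comp hemb (fun x => exp (g x)), he.integral_comp hemb (fun x => exp (g x) * V x),
    he.setIntegral_preimage_emb hemb (fun y => exp (-ψ y)) B] at key

theorem HasLogSobolev.univ {μ : Measure E} [NeZero μ] {d : ℝ}
    (h : ∀ R, 0 < R → HasLogSobolev μ (Metric.closedBall 0 R) d) :
    HasLogSobolev μ Set.univ d := by
  intro ψ g V hψ hψi hg hf hfg hfV hle
  rw [Measure.restrict_univ]
  rw [integrableOn_univ] at hψi
  have hlim : Tendsto (fun R => ∫ y in Metric.closedBall 0 R, exp (-ψ y) ∂μ) atTop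
      (𝓝 (∫ y, exp (-ψ y) ∂μ)) :=
    (aecover_closedBall tendsto_id).integral_tendsto_of_countably_generated hψi
  refine le_of_tendsto ((((hlim.log (integral_exp_pos hψi).ne').const_add d).const_mul
    (∫ x, exp (g x) ∂μ)).const_add _) ?_
  filter_upwards [eventually_gt_atTop 0] with R hR
  exact h R hR ψ g V hψ hψi.integrableOn hg hf hfg hfV fun x y _ => hle x y trivial

theorem hasLogSobolev_closedBall_pi (n : ℕ) {R : ℝ} (hR : 0 < R) :
    HasLogSobolev (volume : Measure (Fin n → ℝ)) (Metric.closedBall 0 R) n := by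
  induction n with
  | zero =>
    intro ψ g V _ _ _ _ _ _ hle
    rw [show Metric.closedBall (0 : Fin 0 → ℝ) R = Set.univ from
      Set.eq_univ_of_forall fun x => by simp [Subsingleton.elim x 0, hR.le],
      Measure.restrict_univ, Measure.volume_pi_eq_dirac 0]
    simp only [integral_dirac, log_exp]
    have h1 := mul_le_mul_of_nonneg_left (hle 0 0 (by simp [hR.le])) (exp_pos (g 0)).le
    simp only [map_zero] at h1
    push_cast
    linarith
  | succ n ih =>
    have hprod := ih.prod (isCompact_closedBall 0 R) (by simp [hR.le])
      (Metric.measure_closedBall_pos _ _ hR).ne' hR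
    rw [Nat.cast_succ]
    have he : MeasurePreserving (Fin.consEquivL ℝ fun _ : Fin (n + 1) => ℝ) volume volume := by
      rw [show ⇑(Fin.consEquivL ℝ fun _ : Fin (n + 1) => ℝ)
          = (MeasurableEquiv.piFinSuccAbove (fun _ : Fin (n + 1) => ℝ) 0).symm by
        funext p i
        refine Fin.cases ?_ (fun j => ?_) i <;> simp [MeasurableEquiv.piFinSuccAbove]]
      exact (volume_preserving_piFinSuccAbove (fun _ : Fin (n + 1) => ℝ) 0).symm
    refine HasLogSobolev.of_measurePreserving _ he ?_
    rwa [show Fin.consEquivL ℝ (fun _ : Fin (n + 1) => ℝ) ⁻¹' Metric.closedBall 0 R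
        = Set.Icc (-R) R ×ˢ Metric.closedBall 0 R by
      ext ⟨t, z⟩
      simp [pi_norm_le_iff_of_nonneg hR.le, Fin.forall_fin_succ, abs_le]]

theorem hasLogSobolev_euclideanSpace (n : ℕ) :
    HasLogSobolev (volume : Measure (EuclideanSpace ℝ (Fin n))) Set.univ n :=
  HasLogSobolev.of_measurePreserving (EuclideanSpace.equiv (Fin n) ℝ).symm
    (PiLp.volume_preserving_toLp (Fin n))
    (HasLogSobolev.univ fun _ => hasLogSobolev_closedBall_pi n)

end Tensorization

section VirialIdentity

variable {E : Type*} [NormedAddCommGroup E] [NormedSpace ℝ E] [MeasurableSpace E] [BorelSpace E]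
  [FiniteDimensional ℝ E]

open Module in
/-- The integration by parts `∫ x · ∇φ e^{-φ} = n ∫ e^{-φ}`, obtained by dilation, hence without
any decay assumption at infinity. -/
theorem integral_exp_neg_mul_fderiv_self (μ : Measure E) [μ.IsAddHaarMeasure] {φ : E → ℝ}
    (hφ : ContDiff ℝ 1 φ) (hi : Integrable (fun x => exp (-φ x)) μ)
    (hi' : Integrable (fun x => exp (-φ x) * fderiv ℝ φ x x) μ) :
    ∫ x, exp (-φ x) * fderiv ℝ φ x x ∂μ = finrank ℝ E * ∫ x, exp (-φ x) ∂μ := by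
  set n := finrank ℝ E with hn
  have hφd : Differentiable ℝ φ := hφ.differentiable one_ne_zero
  have hφc := hφ.continuous
  have hfc : Continuous (fderiv ℝ φ) := hφ.continuous_fderiv one_ne_zero
  set κ : E → ℝ := fun x => exp (-φ x) * fderiv ℝ φ x x with hκ
  set k : ℝ → E → ℝ := fun t x => exp (-φ (t • x)) * fderiv ℝ φ (t • x) x with hk
  have hkκ : ∀ t, 0 < t → k t = fun x => t⁻¹ * κ (t • x) := fun t ht => by
    funext x
    simp only [hk, hκ, map_smul, smul_eq_mul]
    field_simp
  have hkc : Continuous (Function.uncurry k) := by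
    simp only [hk, Function.uncurry_def]
    exact (by fun_prop : Continuous fun p : ℝ × E => exp (-φ (p.1 • p.2))).mul
      ((hfc.comp (by fun_prop : Continuous fun p : ℝ × E => p.1 • p.2)).clm_apply continuous_snd)
  have hpow : ContinuousOn (fun t : ℝ => t⁻¹ * (t ^ n)⁻¹) (Set.Icc 1 2) := by
    have h0 : ∀ t ∈ Set.Icc (1 : ℝ) 2, t ≠ 0 := fun t ht => by linarith [ht.1]
    exact (continuousOn_id.inv₀ h0).mul
      ((continuousOn_id.pow n).inv₀ fun t ht => pow_ne_zero _ (h0 t ht))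
  have hmem : ∀ᵐ t ∂volume.restrict (Set.uIoc (1 : ℝ) 2), t ∈ Set.Ioc (1 : ℝ) 2 := by
    rw [Set.uIoc_of_le one_le_two]
    exact ae_restrict_mem measurableSet_Ioc
  have hint : Integrable (Function.uncurry k)
      ((volume.restrict (Set.uIoc (1 : ℝ) 2)).prod μ) := by
    rw [integrable_prod_iff hkc.aestronglyMeasurable]
    constructor
    · filter_upwards [hmem] with t ht
      have ht0 : 0 < t := by linarith [ht.1]
      change Integrable (k t) μ
      rw [hkκ t ht0]
      exact ((integrable_comp_smul_iff μ κ ht0.ne').2 hi').const_mul _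
    · have h1 : Integrable (fun t : ℝ => t⁻¹ * (t ^ n)⁻¹ * ∫ x, ‖κ x‖ ∂μ)
          (volume.restrict (Set.uIoc (1 : ℝ) 2)) := by
        rw [Set.uIoc_of_le one_le_two]
        exact (hpow.integrableOn_compact isCompact_Icc |>.mono_set
          Set.Ioc_subset_Icc_self).mul_const _
      refine h1.congr ?_
      filter_upwards [hmem] with t ht
      have ht0 : 0 < t := by linarith [ht.1]
      change _ = ∫ x, ‖k t x‖ ∂μ
      rw [hkκ t ht0]
      simp only [norm_mul, Real.norm_of_nonneg (inv_nonneg.2 ht0.le)]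
      rw [integral_const_mul,
        Measure.integral_comp_smul_of_nonneg μ (fun x => ‖κ x‖) t (hR := ht0.le), smul_eq_mul,
        mul_assoc]
  have hswap := intervalIntegral_integral_swap hint
  have hderiv : ∀ x t, HasDerivAt (fun s : ℝ => -exp (-φ (s • x))) (k t x) t := fun x t => by
    have h1 := (hφd (t • x)).hasFDerivAt.comp_hasDerivAt t ((hasDerivAt_id t).smul_const x)
    have h2 := h1.neg.exp.neg
    refine h2.congr_deriv ?_
    simp [hk]
  have hleft : ∀ x, ∫ t in (1 : ℝ)..2, k t x = exp (-φ x) - exp (-φ ((2 : ℝ) • x)) := fun x => by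
    rw [intervalIntegral.integral_eq_sub_of_hasDerivAt (fun t _ => hderiv x t)
      ((hkc.comp (by fun_prop : Continuous fun t : ℝ => (t, x))).intervalIntegrable _ _), one_smul]
    ring
  have hright : ∫ t in (1 : ℝ)..2, ∫ x, k t x ∂μ
      = (∫ t in (1 : ℝ)..2, t⁻¹ * (t ^ n)⁻¹) * ∫ x, κ x ∂μ := by
    rw [← intervalIntegral.integral_mul_const]
    refine intervalIntegral.integral_congr fun t ht => ?_
    rw [Set.uIcc_of_le one_le_two] at ht
    have ht0 : 0 < t := by linarith [ht.1]
    simp only [hkκ t ht0]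
    rw [integral_const_mul, Measure.integral_comp_smul_of_nonneg μ κ t (hR := ht0.le), smul_eq_mul,
      mul_assoc]
  have hftc : ∫ t in (1 : ℝ)..2, n * (t⁻¹ * (t ^ n)⁻¹) = 1 - ((2 : ℝ) ^ n)⁻¹ := by
    have h1 : ∀ t ∈ Set.uIcc (1 : ℝ) 2,
        HasDerivAt (fun t : ℝ => -(t ^ n)⁻¹) (n * (t⁻¹ * (t ^ n)⁻¹)) t := fun t ht => by
      rw [Set.uIcc_of_le one_le_two] at ht
      have ht0 : t ≠ 0 := by linarith [ht.1]
      refine ((hasDerivAt_pow n t).fun_inv (pow_ne_zero n ht0)).fun_neg.congr_deriv ?_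
      clear_value n
      rcases n with _ | n
      · simp
      · simp only [Nat.add_sub_cancel]
        field_simp
        ring
    rw [intervalIntegral.integral_eq_sub_of_hasDerivAt h1
      ((hpow.const_mul _).mono (by simp) |>.intervalIntegrable)]
    simp
    ring
  rw [intervalIntegral.integral_const_mul] at hftc
  have hcpos : 0 < ∫ t in (1 : ℝ)..2, t⁻¹ * (t ^ n)⁻¹ :=
    intervalIntegral.intervalIntegral_pos_of_pos_on
      (hpow.mono (by simp) |>.intervalIntegrable)
      (fun t ht => by have : 0 < t := by linarith [ht.1]
                      positivity) one_lt_two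
  simp_rw [hleft] at hswap
  rw [hright, integral_sub hi ((integrable_comp_smul_iff μ _ two_ne_zero).2 hi),
    Measure.integral_comp_smul_of_nonneg μ (fun x => exp (-φ x)) 2 (hR := zero_le_two),
    smul_eq_mul, ← hn] at hswap
  refine mul_left_cancel₀ hcpos.ne' ?_
  linear_combination hswap - (∫ x, exp (-φ x) ∂μ) * hftc

end VirialIdentity

section Legendre

variable {n : ℕ} {φ : EuclideanSpace ℝ (Fin n) → ℝ}

theorem bddAbove_range_inner_sub (hφ : Continuous φ)
    (hcoer : Tendsto (fun x => φ x / ‖x‖) (cobounded (EuclideanSpace ℝ (Fin n))) atTop)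
    (y : EuclideanSpace ℝ (Fin n)) : BddAbove (Set.range fun z => ⟪y, z⟫ - φ z) := by
  obtain ⟨r, hr⟩ := (hasBasis_cobounded_norm.eventually_iff).1 (hcoer.eventually_ge_atTop ‖y‖)
  obtain ⟨C, hC⟩ := (isCompact_closedBall (0 : EuclideanSpace ℝ (Fin n)) (max r 0)).bddAbove_image
    (by fun_prop : Continuous fun z => ⟪y, z⟫ - φ z).continuousOn
  refine ⟨max C 0, ?_⟩
  rintro _ ⟨z, rfl⟩
  by_cases hz : ‖z‖ ≤ max r 0
  · exact (hC ⟨z, by simpa using hz, rfl⟩).trans (le_max_left _ _)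
  · obtain ⟨hz1, hz2⟩ := max_lt_iff.1 (not_le.1 hz)
    have h1 : ‖y‖ ≤ φ z / ‖z‖ := hr.2 hz1.le
    rw [le_div_iff₀ hz2] at h1
    exact le_max_of_le_right (by linarith [real_inner_le_norm y z])

theorem inner_sub_le_legendre (hφ : Continuous φ)
    (hcoer : Tendsto (fun x => φ x / ‖x‖) (cobounded (EuclideanSpace ℝ (Fin n))) atTop)
    (y z : EuclideanSpace ℝ (Fin n)) : ⟪y, z⟫ - φ z ≤ legendre φ y :=
  le_ciSup (bddAbove_range_inner_sub hφ hcoer y) z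

theorem add_fderiv_sub_le_of_convexOn (hφ : Differentiable ℝ φ) (hconv : ConvexOn ℝ Set.univ φ)
    (x z : EuclideanSpace ℝ (Fin n)) : φ x + fderiv ℝ φ x (z - x) ≤ φ z := by
  have hline : ConvexOn ℝ Set.univ (φ ∘ AffineMap.lineMap (k := ℝ) x z) := by
    simpa using hconv.comp_affineMap (AffineMap.lineMap (k := ℝ) x z)
  have hd : HasDerivAt (φ ∘ AffineMap.lineMap (k := ℝ) x z) (fderiv ℝ φ x (z - x)) 0 := by
    refine HasFDerivAt.comp_hasDerivAt (0 : ℝ) ?_ AffineMap.hasDerivAt_lineMap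
    simpa using (hφ x).hasFDerivAt
  have h := hline.le_slope_of_hasDerivAt (Set.mem_univ 0) (Set.mem_univ 1) one_pos hd
  simp only [slope_def_field, Function.comp_apply, AffineMap.lineMap_apply_zero,
    AffineMap.lineMap_apply_one, sub_zero, div_one] at h
  linarith

theorem legendre_gradient (hφ : Differentiable ℝ φ) (hconv : ConvexOn ℝ Set.univ φ)
    (x : EuclideanSpace ℝ (Fin n)) : legendre φ (gradient φ x) = fderiv ℝ φ x x - φ x := by
  have h1 : ∀ z, ⟪gradient φ x, z⟫ - φ z ≤ fderiv ℝ φ x x - φ x := fun z => by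
    have := add_fderiv_sub_le_of_convexOn hφ hconv x z
    rw [map_sub] at this
    rw [inner_gradient_left]
    linarith
  refine le_antisymm (ciSup_le h1) ?_
  rw [← inner_gradient_left]
  exact le_ciSup (f := fun z => ⟪gradient φ x, z⟫ - φ z) ⟨_, Set.forall_mem_range.2 h1⟩ x

end Legendre

theorem euclidean_log_sobolev (n : ℕ) (φ : EuclideanSpace ℝ (Fin n) → ℝ)
    (hφ : ContDiff ℝ 1 φ) (hconv : StrictConvexOn ℝ Set.univ φ)
    (hcoer : Tendsto (fun x => φ x / ‖x‖) (cobounded (EuclideanSpace ℝ (Fin n))) atTop)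
    (hnorm : ∫ x, Real.exp (-φ x) = 1) :
    (∀ lam : ℝ, 0 < lam → ∀ g : EuclideanSpace ℝ (Fin n) → ℝ, ContDiff ℝ 1 g →
      Integrable (fun x => Real.exp (g x)) →
      Integrable (fun x =>
        Real.exp (g x) * Real.log (Real.exp (g x) / ∫ y, Real.exp (g y))) →
      Integrable (fun x => legendre φ (-(lam • gradient g x)) * Real.exp (g x)) →
      Ent volume (fun x => Real.exp (g x)) ≤
        -(n : ℝ) * Real.log (lam * Real.exp 1) * (∫ x, Real.exp (g x))
          + ∫ x, legendre φ (-(lam • gradient g x)) * Real.exp (g x)) ∧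
    (∀ xb : EuclideanSpace ℝ (Fin n),
      Integrable (fun x =>
        Real.exp (-φ (x - xb)) *
          Real.log (Real.exp (-φ (x - xb)) / ∫ y, Real.exp (-φ (y - xb)))) →
      Integrable (fun x =>
        legendre φ (-((1 : ℝ) • gradient (fun y => -φ (y - xb)) x)) *
          Real.exp (-φ (x - xb))) →
      Ent volume (fun x => Real.exp (-φ (x - xb))) =
        -(n : ℝ) * Real.log (1 * Real.exp 1) * (∫ x, Real.exp (-φ (x - xb)))
          + ∫ x, legendre φ (-((1 : ℝ) • gradient (fun y => -φ (y - xb)) x)) *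
              Real.exp (-φ (x - xb))) := by
  have hφd : Differentiable ℝ φ := hφ.differentiable one_ne_zero
  have hφi : Integrable fun x => Real.exp (-φ x) := by
    by_contra h
    rw [integral_undef h] at hnorm
    exact zero_ne_one hnorm
  constructor
  · intro lam hlam g hg hgi hent hleg
    have hM : 0 < ∫ x, Real.exp (g x) := integral_exp_pos hgi
    set M := ∫ x, Real.exp (g x) with hMdef
    have hentg : ∀ x, Real.exp (g x) * Real.log (Real.exp (g x) / M)
        = Real.exp (g x) * g x - log M * Real.exp (g x) := fun x => by
      rw [log_div (exp_pos _).ne' hM.ne', log_exp]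
      ring
    have hgg : Integrable fun x => Real.exp (g x) * g x := by
      refine (hent.add (hgi.const_mul (log M))).congr (Eventually.of_forall fun x => ?_)
      simp only [Pi.add_apply, hentg]
      ring
    have hEnt : Ent volume (fun x => Real.exp (g x))
        = (∫ x, Real.exp (g x) * g x) - log M * M := by
      simp only [Ent, ← hMdef, hentg]
      rw [integral_sub hgg (hgi.const_mul _), integral_const_mul]
    simp only [mul_comm (legendre φ _)] at hleg ⊢
    have key := hasLogSobolev_euclideanSpace n (fun y => φ (lam⁻¹ • y)) g
      (fun x => legendre φ (-(lam • gradient g x))) (hφ.continuous.comp (continuous_const_smul _))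
      (integrableOn_univ.2 ((integrable_comp_smul_iff volume _
        (inv_ne_zero hlam.ne')).2 hφi)) hg hgi hgg hleg fun x y _ => by
          refine le_trans (le_of_eq ?_)
            (inner_sub_le_legendre hφ.continuous hcoer _ (lam⁻¹ • y))
          rw [inner_neg_left, inner_smul_left, inner_smul_right, inner_gradient_left]
          simp [hlam.ne']
    rw [Measure.restrict_univ,
      Measure.integral_comp_inv_smul_of_nonneg volume (fun y => Real.exp (-φ y)) hlam.le, hnorm,
      finrank_euclideanSpace_fin, smul_eq_mul, mul_one, log_pow] at key
    rw [hEnt, log_mul hlam.ne' (exp_pos 1).ne', log_exp]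
    linarith
  · intro xb hent hleg
    have hgrad : ∀ x, -((1 : ℝ) • gradient (fun y => -φ (y - xb)) x) = gradient φ (x - xb) :=
      fun x => by
        simp [gradient, fderiv_fun_neg, fderiv_comp_sub]
    have hnorm' : ∫ x, Real.exp (-φ (x - xb)) = 1 := by
      rw [integral_sub_right_eq_self (fun x => Real.exp (-φ x)), hnorm]
    simp only [hgrad, legendre_gradient hφd hconv.convexOn, Ent, hnorm', div_one, log_exp]
      at hent hleg ⊢
    rw [integral_sub_right_eq_self (fun x => Real.exp (-φ x) * -φ x),
      integral_sub_right_eq_self (fun x => (fderiv ℝ φ x x - φ x) * Real.exp (-φ x))]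
    replace hent : Integrable fun x => Real.exp (-φ x) * -φ x := by
      simpa using hent.comp_add_right xb
    replace hleg : Integrable fun x => (fderiv ℝ φ x x - φ x) * Real.exp (-φ x) := by
      simpa using hleg.comp_add_right xb
    have hdiff : Integrable fun x => Real.exp (-φ x) * fderiv ℝ φ x x := by
      refine (hleg.sub hent).congr (Eventually.of_forall fun x => ?_)
      simp only [Pi.sub_apply]
      ring
    have hvirial := integral_exp_neg_mul_fderiv_self volume hφ hφi hdiff
    rw [finrank_euclideanSpace_fin, hnorm] at hvirial
    have hsum : ∫ x, (fderiv ℝ φ x x - φ x) * Real.exp (-φ x)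
        = (∫ x, Real.exp (-φ x) * fderiv ℝ φ x x) + ∫ x, Real.exp (-φ x) * -φ x := by
      rw [← integral_add hdiff hent]
      exact integral_congr_ae (Eventually.of_forall fun x => by ring)
    rw [hsum, hvirial, one_mul, log_exp]
    ring
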